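/- For every integer k ≥ 0 and all real numbers W ≥ 0 and w > 0, one has (W + w) + w·W^{k+1} / ( (W + w)^{k+1} − W^{k+1} ) ≤ ((k + 2)/(k + 1))·(W + w). (Note that (W+w)^{k+1} − W^{k+1} > 0 since w > 0, so the quotient is well defined.) -/

import Mathlib

theorem pow_bernoulli_aux (k : ℕ) (W w : ℝ) (hW : 0 ≤ W) (hw : 0 < w) :
    W ^ (k + 1) + ((k : ℝ) + 1) * W ^ k * w ≤ (W + w) ^ (k + 1) := by
  induction k with
  | zero => simp
  | succ n ih =>
    have h1 : 0 ≤ ((n : ℝ) + 1) * W ^ n * w * w := by positivity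
    have h2 := mul_le_mul_of_nonneg_right ih (by positivity : 0 ≤ W + w)
    rw [pow_succ (W + w) (n + 1)]
    refine le_trans ?_ h2
    push_cast
    have e : (W ^ (n + 1) + ((n : ℝ) + 1) * W ^ n * w) * (W + w)
      = W ^ (n + 1 + 1) + ((n : ℝ) + 1 + 1) * W ^ (n + 1) * w
        + ((n : ℝ) + 1) * W ^ n * w * w := by ring
    linarith

/-- Key pointwise inequality of the Second Delay Lemma: for `k ≥ 0`, `W ≥ 0`, `w > 0`,
`(W + w) + w·W^{k+1} / ((W + w)^{k+1} − W^{k+1}) ≤ ((k + 2)/(k + 1))·(W + w)`. -/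
theorem second_delay_pointwise (k : ℕ) (W w : ℝ) (hW : 0 ≤ W) (hw : 0 < w) :
    (W + w) + w * W ^ (k + 1) / ((W + w) ^ (k + 1) - W ^ (k + 1))
      ≤ (((k : ℝ) + 2) / ((k : ℝ) + 1)) * (W + w) := by
  have hD : 0 < (W + w) ^ (k + 1) - W ^ (k + 1) :=
    sub_pos.2 (pow_lt_pow_left₀ (by linarith) hW (Nat.succ_ne_zero k))
  have hB := pow_bernoulli_aux k W w hW hw
  have hk : (0 : ℝ) < (k : ℝ) + 1 := by positivity
  have key : w * W ^ (k + 1) / ((W + w) ^ (k + 1) - W ^ (k + 1)) ≤ (W + w) / ((k : ℝ) + 1) := by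
    rw [div_le_div_iff₀ hD hk]
    have h1 : W * (((k : ℝ) + 1) * W ^ k * w) ≤ W * ((W + w) ^ (k + 1) - W ^ (k + 1)) :=
      mul_le_mul_of_nonneg_left (by linarith) hW
    have h2 := mul_pos hw hD
    have e : w * W ^ (k + 1) * ((k : ℝ) + 1) = W * (((k : ℝ) + 1) * W ^ k * w) := by ring
    rw [e, add_mul]
    linarith
  have e : (((k : ℝ) + 2) / ((k : ℝ) + 1)) * (W + w) = (W + w) + (W + w) / ((k : ℝ) + 1) := by
    field_simp
    ring
  rw [e]
  linarith
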